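/- Let ℓ be a prime, V a finite-dimensional ℚ_ℓ-vector space, and ρ a representation of ℤ_ℓ^× on V which is continuous in the sense that for each v ∈ V the map σ ↦ ρ(σ)v is continuous. Suppose V carries an increasing filtration by ρ-invariant subspaces W_m (m ∈ ℤ) with ⋂_m W_m = 0, ⋃_m W_m = V, W_{2m+1} = W_{2m} for all m, and such that for every m ∈ ℤ, every σ ∈ ℤ_ℓ^× and every v ∈ W_{2m} one has ρ(σ)v − σ^{−m}·v ∈ W_{2m−2}. Then V decomposes as a direct sum V = ⊕_m V_m of ρ-invariant subspaces such that ρ(σ)v = σ^{−m}·v for all v ∈ V_m and σ ∈ ℤ_ℓ^×, and W_{2m} = ⊕_{k ≤ m} V_k for all m. In particular every such module is a direct sum of Tate twists ℚ_ℓ(−m), which expresses that the weighted completion of ℤ_ℓ^× with respect to the inclusion ℤ_ℓ^× ⊆ ℚ_ℓ^× = G_m(ℚ_ℓ) and the central cocharacter x ↦ x^{−2} is just G_m, with trivial prounipotent radical. -/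

import Mathlib

namespace Module.End

variable {K V : Type*} [Field K] [AddCommGroup V] [Module K V]
  {T : End K V} {μ : ℤ → K} {U : ℤ → Submodule K V}

/-- If `T - μ n` lowers the filtration `U` by one at level `n`, then an eigenvector of `T` in `U n`
whose eigenvalue differs from `μ n` already lies in `U (n - 1)`. -/
theorem mem_sub_one_of_mem_eigenspace
    (hT : ∀ n, ∀ v ∈ U n, T v - μ n • v ∈ U (n - 1)) {a : K} {n : ℤ} (ha : a ≠ μ n)
    {v : V} (hv : v ∈ T.eigenspace a) (hvn : v ∈ U n) : v ∈ U (n - 1) := by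
  have h := hT n v hvn
  rw [mem_eigenspace_iff.mp hv, ← sub_smul] at h
  exact ((U (n - 1)).smul_mem_iff (sub_ne_zero.mpr ha)).mp h

theorem eigenspace_le_of_filtration (hμ : Function.Injective μ)
    (hU : Monotone U) (hsup : ∀ v, ∃ n, v ∈ U n)
    (hT : ∀ n, ∀ v ∈ U n, T v - μ n • v ∈ U (n - 1)) (m : ℤ) :
    T.eigenspace (μ m) ≤ U m := by
  intro v hv
  obtain ⟨n, hn⟩ := hsup v
  have key : ∀ d : ℕ, v ∈ U (m + d) → v ∈ U m := by
    intro d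
    induction d with
    | zero => simp
    | succ d ih =>
      intro h
      have h' := mem_sub_one_of_mem_eigenspace hT (hμ.ne (by omega)) hv h
      exact ih (by convert h' using 2; push_cast; ring)
  exact key (n - m).toNat (hU (by omega) hn)

theorem eq_zero_of_mem_eigenspace_of_mem_filtration (hμ : Function.Injective μ)
    (hU : Monotone U) (hinf : ∀ v, (∀ n, v ∈ U n) → v = 0)
    (hT : ∀ n, ∀ v ∈ U n, T v - μ n • v ∈ U (n - 1)) {m : ℤ} {v : V}
    (hv : v ∈ T.eigenspace (μ m)) (hvm : v ∈ U (m - 1)) : v = 0 := by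
  have key : ∀ d : ℕ, v ∈ U (m - 1 - d) := by
    intro d
    induction d with
    | zero => simpa using hvm
    | succ d ih =>
      have h' := mem_sub_one_of_mem_eigenspace hT (hμ.ne (by omega)) hv ih
      convert h' using 2
      push_cast
      ring
  exact hinf v fun n => hU (by omega) (key (m - 1 - n).toNat)

theorem exists_filtration_eq_bot [FiniteDimensional K V] (hU : Monotone U)
    (hinf : ∀ v, (∀ n, v ∈ U n) → v = 0) : ∃ N : ℤ, ∀ n ≤ N, U n = ⊥ := by
  obtain ⟨N, hN⟩ := IsArtinian.monotone_stabilizes (R := K) (M := V)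
    ⟨fun n : ℕ => OrderDual.toDual (U (-n)), fun a b hab => hU (by simpa using hab)⟩
  have hbot : U (-N) = ⊥ := by
    refine (Submodule.eq_bot_iff _).mpr fun v hv => hinf v fun n => ?_
    rcases le_total (-(N : ℤ)) n with h | h
    · exact hU h hv
    · have h' : U (-N) = U (-((-n).toNat : ℤ)) := hN (-n).toNat (by omega)
      exact hU (by omega) (h' ▸ hv)
  exact ⟨-N, fun n hn => eq_bot_iff.mpr (hbot ▸ hU hn)⟩

/-- Away from the eigenvalue `a`, the map `T - a` is onto a sum of eigenspaces. -/
theorem iSup_eigenspace_le_map_sub {ι : Type*} (p : ι → Prop) (c : ι → K) {a : K}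
    (h : ∀ i, p i → c i ≠ a) :
    (⨆ i, ⨆ _ : p i, T.eigenspace (c i)) ≤
      (⨆ i, ⨆ _ : p i, T.eigenspace (c i)).map (T - algebraMap K (End K V) a) := by
  refine iSup₂_le fun i hi v hv => ?_
  refine ⟨(c i - a)⁻¹ • v, Submodule.smul_mem _ _ ?_, ?_⟩
  · exact (le_iSup₂_of_le (f := fun i (_ : p i) => T.eigenspace (c i)) i hi le_rfl) hv
  rw [map_smul, LinearMap.sub_apply, mem_eigenspace_iff.mp hv, algebraMap_end_apply, ← sub_smul,
    inv_smul_smul₀ (sub_ne_zero.mpr (h i hi))]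

theorem filtration_eq_iSup_eigenspace [FiniteDimensional K V] (hμ : Function.Injective μ)
    (hU : Monotone U) (hinf : ∀ v, (∀ n, v ∈ U n) → v = 0) (hsup : ∀ v, ∃ n, v ∈ U n)
    (hT : ∀ n, ∀ v ∈ U n, T v - μ n • v ∈ U (n - 1)) (m : ℤ) :
    U m = ⨆ k ≤ m, T.eigenspace (μ k) := by
  refine le_antisymm ?_ (iSup₂_le fun k hk =>
    (eigenspace_le_of_filtration hμ hU hsup hT k).trans (hU hk))
  obtain ⟨N, hN⟩ := exists_filtration_eq_bot hU hinf
  have key : ∀ d : ℕ, ∀ n : ℤ, n ≤ N + d → U n ≤ ⨆ k ≤ n, T.eigenspace (μ k) := by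
    intro d
    induction d with
    | zero => exact fun n hn => (hN n (by simpa using hn)).trans_le bot_le
    | succ d ih =>
      intro n hn v hv
      have hlt := ih (n - 1) (by push_cast at hn; omega) (hT n v hv)
      obtain ⟨u, hu, huv⟩ := iSup_eigenspace_le_map_sub (T := T) (fun k => k ≤ n - 1) μ
        (fun k hk => hμ.ne (by omega : k ≠ n)) hlt
      have hle : (⨆ k ≤ n - 1, T.eigenspace (μ k)) ≤ ⨆ k ≤ n, T.eigenspace (μ k) :=
        biSup_mono fun k hk => by omega
      have hvu : v - u ∈ T.eigenspace (μ n) := by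
        rw [mem_eigenspace_iff, map_sub, smul_sub, sub_eq_sub_iff_sub_eq_sub]
        simpa using huv.symm
      have hvu' : v - u ∈ ⨆ k ≤ n, T.eigenspace (μ k) :=
        (le_iSup₂_of_le (f := fun k (_ : k ≤ n) => T.eigenspace (μ k)) n le_rfl le_rfl) hvu
      simpa using add_mem hvu' (hle hu)
  exact key (m - N).toNat m (by omega)

end Module.End

theorem PadicInt.exists_unit_zpow_neg_injective (ℓ : ℕ) [Fact ℓ.Prime] :
    ∃ σ : ℤ_[ℓ]ˣ, Function.Injective fun m : ℤ => ((σ : ℤ_[ℓ]) : ℚ_[ℓ]) ^ (-m) := by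
  have hunit : IsUnit ((ℓ + 1 : ℕ) : ℤ_[ℓ]) := by
    rw [PadicInt.isUnit_iff, PadicInt.norm_natCast_eq_one_iff]
    simp
  refine ⟨hunit.unit, fun a b hab => ?_⟩
  have hℓ := (Fact.out : ℓ.Prime).one_lt
  have h : ((ℓ + 1 : ℕ) : ℚ) ^ (-a) = ((ℓ + 1 : ℕ) : ℚ) ^ (-b) := by
    have h' : ((ℓ + 1 : ℕ) : ℚ_[ℓ]) ^ (-a) = ((ℓ + 1 : ℕ) : ℚ_[ℓ]) ^ (-b) := by
      simpa using hab
    apply Rat.cast_injective (α := ℚ_[ℓ])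
    simpa only [Rat.cast_zpow, Rat.cast_natCast] using h'
  exact neg_injective (zpow_right_injective₀ (by positivity) (by norm_cast; omega) h)


/-- Every ℓ-adic mixed Tate module over `ℤ_ℓˣ` (a finite-dimensional continuous
representation of `ℤ_ℓˣ` over `ℚ_ℓ` with a weight filtration whose odd graded
quotients vanish and on whose `2m`-th graded quotient `σ` acts as `σ^{-m}`)
is a direct sum of Tate twists: the weighted completion of `ℤ_ℓˣ` is `𝔾_m`. -/
theorem mixedTate_module_over_units_padicInt_decomposes
    (ℓ : ℕ) [Fact ℓ.Prime]
    (V : Type*) [AddCommGroup V] [Module ℚ_[ℓ] V] [FiniteDimensional ℚ_[ℓ] V]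
    [TopologicalSpace V] [IsTopologicalAddGroup V] [ContinuousSMul ℚ_[ℓ] V] [T2Space V]
    (ρ : Representation ℚ_[ℓ] ℤ_[ℓ]ˣ V)
    (hρ : ∀ v : V, Continuous fun σ : ℤ_[ℓ]ˣ => ρ σ v)
    (W : ℤ → Submodule ℚ_[ℓ] V)
    (hmono : Monotone W)
    (hinf : (⨅ m, W m) = ⊥) (hsup : (⨆ m, W m) = ⊤)
    (hodd : ∀ m : ℤ, W (2 * m + 1) = W (2 * m))
    (hinv : ∀ (m : ℤ) (σ : ℤ_[ℓ]ˣ), ∀ v ∈ W m, ρ σ v ∈ W m)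
    (hwt : ∀ (m : ℤ) (σ : ℤ_[ℓ]ˣ), ∀ v ∈ W (2 * m),
        ρ σ v - (((σ : ℤ_[ℓ]) : ℚ_[ℓ]) ^ (-m)) • v ∈ W (2 * m - 2)) :
    ∃ V' : ℤ → Submodule ℚ_[ℓ] V,
      DirectSum.IsInternal V' ∧
      (∀ (m : ℤ) (σ : ℤ_[ℓ]ˣ), ∀ v ∈ V' m,
        ρ σ v = (((σ : ℤ_[ℓ]) : ℚ_[ℓ]) ^ (-m)) • v) ∧
      (∀ m : ℤ, W (2 * m) = ⨆ k ≤ m, V' k) := by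
  obtain ⟨σ₀, hσ₀⟩ := PadicInt.exists_unit_zpow_neg_injective ℓ
  have hU : Monotone fun m => W (2 * m) := fun a b hab => hmono (by omega)
  have hUinf : ∀ v, (∀ n, v ∈ W (2 * n)) → v = 0 := fun v hv => by
    rw [← Submodule.mem_bot ℚ_[ℓ], ← hinf, Submodule.mem_iInf]
    exact fun m => hmono (by omega) (hv (m / 2))
  have hUsup : ∀ v, ∃ n, v ∈ W (2 * n) := fun v => by
    obtain ⟨m, hm⟩ := (Submodule.mem_iSup_of_directed W hmono.directed_le).mp
      (hsup ▸ Submodule.mem_top : v ∈ ⨆ m, W m)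
    exact ⟨max m 0, hmono (by omega) hm⟩
  have hUT : ∀ (σ : ℤ_[ℓ]ˣ) (n : ℤ), ∀ v ∈ W (2 * n),
      ρ σ v - (((σ : ℤ_[ℓ]) : ℚ_[ℓ]) ^ (-n)) • v ∈ W (2 * (n - 1)) := fun σ n v hv => by
    rw [mul_sub, mul_one]
    exact hwt n σ v hv
  have hdec := Module.End.filtration_eq_iSup_eigenspace hσ₀ hU hUinf hUsup (hUT σ₀)
  refine ⟨fun m => Module.End.eigenspace (ρ σ₀) (((σ₀ : ℤ_[ℓ]) : ℚ_[ℓ]) ^ (-m)), ?_, ?_, hdec⟩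
  · rw [DirectSum.isInternal_submodule_iff_iSupIndep_and_iSup_eq_top]
    refine ⟨(Module.End.eigenspaces_iSupIndep (ρ σ₀)).comp hσ₀, eq_top_iff.mpr fun v _ => ?_⟩
    obtain ⟨n, hn⟩ := hUsup v
    have hle := (hdec n).trans_le (iSup_mono fun k => iSup_const_le)
    exact hle hn
  · intro m σ v hv
    refine sub_eq_zero.mp (Module.End.eq_zero_of_mem_eigenspace_of_mem_filtration hσ₀ hU hUinf
      (hUT σ₀) (m := m) (sub_mem ?_ (Submodule.smul_mem _ _ hv)) (hUT σ m v
        (Module.End.eigenspace_le_of_filtration hσ₀ hU hUsup (hUT σ₀) m hv)))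
    have hcomm : ρ σ₀ (ρ σ v) = ρ σ (ρ σ₀ v) := by
      rw [← Module.End.mul_apply, ← map_mul, mul_comm, map_mul, Module.End.mul_apply]
    rw [Module.End.mem_eigenspace_iff, hcomm, Module.End.mem_eigenspace_iff.mp hv, map_smul]
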